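/- Let R be a commutative noetherian ring satisfying Auslander's condition (AC), and let M be a finitely generated R-module such that Ext_R^i(M,R) = 0 for all i ≥ 1. Then M is totally reflexive: the natural biduality (evaluation) map M → Hom_R(Hom_R(M,R), R) is an isomorphism, and Ext_R^i(Hom_R(M,R), R) = 0 for all i ≥ 1. In other words, every commutative noetherian ring satisfying (AC) satisfies the condition (GC): every nonzero finitely generated module M with Ext_R^{≥1}(M,R) = 0 has G-dimension 0. -/

import Mathlib

open CategoryTheory

universe u

noncomputable abbrev ExtGroup {A : Type u} [Ring A] (M N : ModuleCat.{u} A) (i : ℕ) :=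
  ((Ext ℤ (ModuleCat.{u} A) i).obj (Opposite.op M)).obj N

/-- Auslander's condition (AC). -/
def SatisfiesAC (A : Type u) [Ring A] : Prop :=
  ∀ M : ModuleCat.{u} A, Module.Finite A M →
    ∃ b : ℕ, ∀ N : ModuleCat.{u} A, Module.Finite A N →
      (∃ n : ℕ, ∀ i ≥ n, Subsingleton (ExtGroup M N i)) →
      ∀ i > b, Subsingleton (ExtGroup M N i)

section ExtVanishing

variable {R : Type u} [CommRing R]

theorem subsingleton_extGroup_succ_iff (M N : ModuleCat.{u} R) (n : ℕ) :
    Subsingleton (ExtGroup M N (n + 1)) ↔ Subsingleton (Abelian.Ext.{u} M N (n + 1)) := by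
  let P := projectiveResolution M
  have e := P.isoExt (R := ℤ) (n + 1) N
  have h₁ : Subsingleton (ExtGroup M N (n + 1)) ↔
      ∀ f : P.complex.X (n + 1) ⟶ N, P.complex.d (n + 2) (n + 1) ≫ f = 0 →
        ∃ g : P.complex.X n ⟶ N, P.complex.d (n + 1) n ≫ g = f := by
    rw [← ModuleCat.isZero_iff_subsingleton, e.isZero_iff,
      ← HomologicalComplex.exactAt_iff_isZero_homology,
      HomologicalComplex.exactAt_iff' _ n (n + 1) (n + 2) (by simp) (by simp),
      ShortComplex.moduleCat_exact_iff]
    rfl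
  rw [h₁]
  constructor
  · intro h
    refine subsingleton_of_forall_eq 0 fun α => ?_
    obtain ⟨f, hf, rfl⟩ := P.extMk_surjective α (n + 2) rfl
    exact (P.extMk_eq_zero_iff f (n + 2) rfl hf n rfl).2 (h f hf)
  · intro h f hf
    exact (P.extMk_eq_zero_iff f (n + 2) rfl hf n rfl).1 (Subsingleton.elim _ _)

variable (R) in
/-- The vanishing of the single group `Ext_R^i(M, N)`. -/
def ExtVanish (M N : Type u) [AddCommGroup M] [Module R M] [AddCommGroup N] [Module R N]
    (i : ℕ) : Prop :=
  Subsingleton (Abelian.Ext.{u} (ModuleCat.of R M) (ModuleCat.of R N) i)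

variable {A B C M N : Type u} [AddCommGroup A] [Module R A] [AddCommGroup B] [Module R B]
  [AddCommGroup C] [Module R C] [AddCommGroup M] [Module R M] [AddCommGroup N] [Module R N]

namespace ExtVanish

open Abelian

theorem of_projective [Module.Projective R M] (i : ℕ) : ExtVanish R M N (i + 1) :=
  have : Projective (ModuleCat.of R M) := (IsProjective.iff_projective M).1 inferInstance
  subsingleton_of_forall_eq 0 fun _ => Ext.eq_zero_of_projective _

theorem of_injective [Module.Injective R N] (i : ℕ) : ExtVanish R M N (i + 1) :=
  have : Injective (ModuleCat.of R N) := Module.injective_object_of_injective_module R N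
  subsingleton_of_forall_eq 0 fun _ => Ext.eq_zero_of_injective _

theorem of_retract {i : ℕ} (h : ExtVanish R M B i) (s : A →ₗ[R] B) (r : B →ₗ[R] A)
    (hrs : r ∘ₗ s = LinearMap.id) : ExtVanish R M A i := by
  unfold ExtVanish at h
  refine subsingleton_of_forall_eq 0 fun x => ?_
  have h₀ : ModuleCat.ofHom s ≫ ModuleCat.ofHom r = 𝟙 (ModuleCat.of R A) := by
    rw [← ModuleCat.ofHom_comp, hrs]; rfl
  have h₁ : (x.comp (Ext.mk₀ (ModuleCat.ofHom s)) (add_zero i)).comp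
      (Ext.mk₀ (ModuleCat.ofHom r)) (add_zero i) = x := by
    rw [Ext.comp_assoc_of_third_deg_zero, Ext.mk₀_comp_mk₀, h₀, Ext.comp_mk₀_id]
  rw [← h₁, Subsingleton.elim (x.comp (Ext.mk₀ (ModuleCat.ofHom s)) (add_zero i)) 0, Ext.zero_comp]

variable {f : A →ₗ[R] B} {g : B →ₗ[R] C}

theorem shortExact (hf : Function.Injective f) (hfg : Function.Exact f g)
    (hg : Function.Surjective g) :
    (ModuleCat.shortComplexOfCompEqZero f g hfg.linearMap_comp_eq_zero).ShortExact :=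
  ModuleCat.shortComplex_shortExact _ hfg hf hg

section

variable (hf : Function.Injective f) (hfg : Function.Exact f g) (hg : Function.Surjective g)
include hf hfg hg

theorem right₁ {i : ℕ} (hC : ExtVanish R M C i) (hB : ExtVanish R M B (i + 1)) :
    ExtVanish R M A (i + 1) := by
  unfold ExtVanish at hC hB
  refine subsingleton_of_forall_eq 0 fun x => ?_
  obtain ⟨y, rfl⟩ := Ext.covariant_sequence_exact₁ _ (shortExact hf hfg hg) x
    (hB.elim _ _) rfl
  rw [hC.elim y 0, Ext.zero_comp]

theorem right₂ {i : ℕ} (hA : ExtVanish R M A i) (hC : ExtVanish R M C i) :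
    ExtVanish R M B i := by
  unfold ExtVanish at hA hC
  refine subsingleton_of_forall_eq 0 fun x => ?_
  obtain ⟨y, rfl⟩ := Ext.covariant_sequence_exact₂ _ (shortExact hf hfg hg) x (hC.elim _ _)
  rw [hA.elim y 0, Ext.zero_comp]

theorem right₃ {i : ℕ} (hB : ExtVanish R M B i) (hA : ExtVanish R M A (i + 1)) :
    ExtVanish R M C i := by
  unfold ExtVanish at hA hB
  refine subsingleton_of_forall_eq 0 fun x => ?_
  obtain ⟨y, rfl⟩ := Ext.covariant_sequence_exact₃ _ (shortExact hf hfg hg) x rfl (hA.elim _ _)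
  rw [hB.elim y 0, Ext.zero_comp]

theorem left₁ {i : ℕ} (hB : ExtVanish R B N i) (hC : ExtVanish R C N (i + 1)) :
    ExtVanish R A N i := by
  unfold ExtVanish at hB hC
  refine subsingleton_of_forall_eq 0 fun x => ?_
  obtain ⟨y, rfl⟩ := Ext.contravariant_sequence_exact₁ (shortExact hf hfg hg) _ x (add_comm 1 i)
    (hC.elim _ _)
  rw [hB.elim y 0, Ext.comp_zero]

theorem left₃ {i : ℕ} (hA : ExtVanish R A N i) (hB : ExtVanish R B N (i + 1)) :
    ExtVanish R C N (i + 1) := by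
  unfold ExtVanish at hA hB
  refine subsingleton_of_forall_eq 0 fun x => ?_
  obtain ⟨y, rfl⟩ := Ext.contravariant_sequence_exact₃ (shortExact hf hfg hg) _ x
    (hB.elim _ _) (add_comm 1 i)
  rw [hA.elim y 0, Ext.comp_zero]

theorem exists_lift (hA : ExtVanish R M A 1) (φ : M →ₗ[R] C) :
    ∃ ψ : M →ₗ[R] B, g ∘ₗ ψ = φ := by
  unfold ExtVanish at hA
  obtain ⟨y, hy⟩ := Ext.covariant_sequence_exact₃ (ModuleCat.of R M) (shortExact hf hfg hg)
    (Ext.mk₀ (ModuleCat.ofHom φ)) (zero_add 1) (hA.elim _ _)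
  obtain ⟨ψ, rfl⟩ := Ext.mk₀_bijective _ _ |>.surjective y
  rw [Ext.mk₀_comp_mk₀] at hy
  have := Ext.mk₀_bijective _ _ |>.injective hy
  exact ⟨ψ.hom, congrArg ModuleCat.Hom.hom this⟩

theorem exists_extension (hC : ExtVanish R C N 1) (φ : A →ₗ[R] N) :
    ∃ ψ : B →ₗ[R] N, ψ ∘ₗ f = φ := by
  unfold ExtVanish at hC
  obtain ⟨y, hy⟩ := Ext.contravariant_sequence_exact₁ (shortExact hf hfg hg) (ModuleCat.of R N)
    (Ext.mk₀ (ModuleCat.ofHom φ)) (add_zero 1) (hC.elim _ _)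
  obtain ⟨ψ, rfl⟩ := Ext.mk₀_bijective _ _ |>.surjective y
  rw [Ext.mk₀_comp_mk₀] at hy
  have := Ext.mk₀_bijective _ _ |>.injective hy
  exact ⟨ψ.hom, congrArg ModuleCat.Hom.hom this⟩

theorem one_of_exists_extension (hB : ExtVanish R B N 1)
    (h : ∀ φ : A →ₗ[R] N, ∃ ψ : B →ₗ[R] N, ψ ∘ₗ f = φ) : ExtVanish R C N 1 := by
  unfold ExtVanish at hB
  refine subsingleton_of_forall_eq 0 fun x => ?_
  obtain ⟨y, rfl⟩ := Ext.contravariant_sequence_exact₃ (shortExact hf hfg hg) _ x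
    (hB.elim _ _) (add_zero 1)
  obtain ⟨φ, rfl⟩ := Ext.mk₀_bijective _ _ |>.surjective y
  obtain ⟨ψ, hψ⟩ := h φ.hom
  have : φ = ModuleCat.ofHom f ≫ ModuleCat.ofHom ψ := by
    rw [← ModuleCat.ofHom_comp, hψ]; rfl
  rw [this, ← Ext.mk₀_comp_mk₀, ShortComplex.ShortExact.extClass_comp_assoc]

end

theorem prod {i : ℕ} (hA : ExtVanish R M A i) (hB : ExtVanish R M B i) :
    ExtVanish R M (A × B) i :=
  right₂ LinearMap.inl_injective (Function.Exact.inl_snd (R := R)) LinearMap.snd_surjective hA hB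

end ExtVanish

end ExtVanishing

section StableVanishing

variable {R : Type u} [CommRing R]

section

variable {M N N' M' : Type u} [AddCommGroup M] [Module R M] [AddCommGroup N] [Module R N]
  [AddCommGroup M'] [Module R M'] [AddCommGroup N'] [Module R N']

/-- A linear map is stably zero if it factors through a projective module. -/
def StablyZero (g : M →ₗ[R] N) : Prop :=
  ∃ (P : Type u) (_ : AddCommGroup P) (_ : Module R P) (_ : Module.Projective R P)
    (a : M →ₗ[R] P) (b : P →ₗ[R] N), b ∘ₗ a = g

namespace StablyZero

theorem of_projective_target [Module.Projective R N] (g : M →ₗ[R] N) : StablyZero g :=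
  ⟨N, _, _, ‹_›, g, LinearMap.id, rfl⟩

theorem zero : StablyZero (0 : M →ₗ[R] N) :=
  ⟨PUnit, _, _, inferInstance, 0, 0, rfl⟩

theorem comp_left {g : M →ₗ[R] N} (hg : StablyZero g) (h : N →ₗ[R] N') : StablyZero (h ∘ₗ g) := by
  obtain ⟨P, _, _, _, a, b, rfl⟩ := hg
  exact ⟨P, _, _, ‹_›, a, h ∘ₗ b, rfl⟩

theorem add {g g' : M →ₗ[R] N} (hg : StablyZero g) (hg' : StablyZero g') :
    StablyZero (g + g') := by
  obtain ⟨P, _, _, _, a, b, rfl⟩ := hg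
  obtain ⟨P', _, _, _, a', b', rfl⟩ := hg'
  exact ⟨P × P', _, _, inferInstance, a.prod a', b.coprod b', by ext; simp⟩

end StablyZero

end

theorem exists_finset_forall_mem_supported {M ι : Type u} [AddCommGroup M] [Module R M]
    [Module.Finite R M] (φ : M →ₗ[R] ι →₀ R) :
    ∃ t : Finset ι, ∀ x, φ x ∈ Finsupp.supported R R (t : Set ι) := by
  classical
  obtain ⟨s, hs⟩ := Module.Finite.fg_top (R := R) (M := M)
  refine ⟨s.biUnion fun x => (φ x).support, fun x => ?_⟩
  have hx : x ∈ Submodule.span R (s : Set M) := hs ▸ Submodule.mem_top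
  refine (Submodule.span_le.2 ?_ : _ ≤ (Finsupp.supported R R _).comap φ) hx
  intro y hy
  rw [Submodule.comap_coe, Set.mem_preimage, SetLike.mem_coe, Finsupp.mem_supported]
  exact_mod_cast Finset.subset_biUnion_of_mem (fun x => (φ x).support) hy

variable (R) in
/-- Finitely generated modules `M` with `Ext_R^i(M, R) = 0` for all `i ≥ 1`. -/
structure IsExtAcyclic (M : Type u) [AddCommGroup M] [Module R M] : Prop where
  finite : Module.Finite R M
  extVanish : ∀ i, ExtVanish R M R (i + 1)

namespace IsExtAcyclic

variable [IsNoetherianRing R] {M N : Type u} [AddCommGroup M] [Module R M] [AddCommGroup N]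
  [Module R N]

theorem ker (hM : IsExtAcyclic R M) {P : Type u} [AddCommGroup P] [Module R P]
    [Module.Finite R P] [Module.Projective R P] {g : P →ₗ[R] M} (hg : Function.Surjective g) :
    IsExtAcyclic R (LinearMap.ker g) where
  finite := inferInstance
  extVanish i := ExtVanish.left₁ (Submodule.injective_subtype _) g.exact_subtype_ker_map hg
    (.of_projective i) (hM.extVanish (i + 1))

theorem extVanish_finsupp (hM : IsExtAcyclic R M) (ι : Type u) (i : ℕ) :
    ExtVanish R M (ι →₀ R) (i + 1) := by
  induction i generalizing M with
  | zero =>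
    have := hM.finite
    obtain ⟨n, p, hp⟩ := Module.Finite.exists_fin' R M
    refine ExtVanish.one_of_exists_extension (Submodule.injective_subtype _)
      p.exact_subtype_ker_map hp (.of_projective 0) fun φ => ?_
    choose ψ hψ using fun j : ι => ExtVanish.exists_extension (Submodule.injective_subtype _)
      p.exact_subtype_ker_map hp (hM.extVanish 0) (Finsupp.lapply j ∘ₗ φ)
    obtain ⟨t, ht⟩ := exists_finset_forall_mem_supported φ
    classical
    refine ⟨∑ j ∈ t, Finsupp.lsingle j ∘ₗ ψ j, ?_⟩
    refine LinearMap.ext fun x => Finsupp.ext fun k => ?_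
    have h₁ : ∀ j, ψ j (x : Fin n → R) = φ x j := fun j => LinearMap.congr_fun (hψ j) x
    simp only [LinearMap.coe_comp, Function.comp_apply, LinearMap.coe_sum, Finset.sum_apply,
      Submodule.subtype_apply, Finsupp.coe_finsetSum, Finsupp.lsingle_apply, h₁]
    simp only [Finsupp.single_apply, Finset.sum_ite_eq']
    split_ifs with hk
    · rfl
    · exact (Finsupp.notMem_support_iff.1 fun h => hk (ht x h)).symm
  | succ i ih =>
    have := hM.finite
    obtain ⟨n, p, hp⟩ := Module.Finite.exists_fin' R M
    exact ExtVanish.left₃ (Submodule.injective_subtype _) p.exact_subtype_ker_map hp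
      (ih (hM.ker hp)) (.of_projective _)

theorem extVanish_projective (hM : IsExtAcyclic R M) [Module.Projective R N] (i : ℕ) :
    ExtVanish R M N (i + 1) := by
  obtain ⟨s, hs⟩ := Module.projective_def'.1 ‹Module.Projective R N›
  exact (hM.extVanish_finsupp N i).of_retract s _ hs

/-- Under (AC), an Ext-acyclic module has Auslander bound zero. -/
theorem extVanish_of_eventually (hAC : SatisfiesAC R) (hM : IsExtAcyclic R M)
    [Module.Finite R N] (hN : ∃ n, ∀ i ≥ n, ExtVanish R M N i) (i : ℕ) :
    ExtVanish R M N (i + 1) := by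
  obtain ⟨b, hb⟩ := hAC (ModuleCat.of R M) hM.finite
  have key : ∀ (k : ℕ) (N : Type u) [AddCommGroup N] [Module R N], Module.Finite R N →
      (∃ n, ∀ i ≥ n, ExtVanish R M N i) → ∀ i, b < i + 1 + k → ExtVanish R M N (i + 1) := by
    intro k
    induction k with
    | zero =>
      intro N _ _ _ ⟨n, hn⟩ i hi
      refine (subsingleton_extGroup_succ_iff _ _ _).1
        (hb (ModuleCat.of R N) ‹_› ⟨n + 1, fun j hj => ?_⟩ _ hi)
      obtain ⟨j, rfl⟩ : ∃ l, j = l + 1 := ⟨j - 1, by omega⟩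
      exact (subsingleton_extGroup_succ_iff _ _ _).2 (hn (j + 1) (by omega))
    | succ k ih =>
      intro N _ _ _ ⟨n, hn⟩ i hi
      obtain ⟨m, p, hp⟩ := Module.Finite.exists_fin' R N
      refine ExtVanish.right₃ (Submodule.injective_subtype _) p.exact_subtype_ker_map hp
        (hM.extVanish_projective i) (ih (LinearMap.ker p) inferInstance ⟨n + 1, fun j hj => ?_⟩
          (i + 1) (by omega))
      obtain ⟨j, rfl⟩ : ∃ l, j = l + 1 := ⟨j - 1, by omega⟩
      exact ExtVanish.right₁ (Submodule.injective_subtype _) p.exact_subtype_ker_map hp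
        (hn j (by omega)) (hM.extVanish_projective j)
  exact key b N ‹_› hN i (by omega)

theorem stablyZero_of_finite (hAC : SatisfiesAC R) (hM : IsExtAcyclic R M)
    [Module.Finite R N] (hN : ∃ n, ∀ i ≥ n, ExtVanish R M N i) (g : M →ₗ[R] N) :
    StablyZero g := by
  obtain ⟨m, p, hp⟩ := Module.Finite.exists_fin' R N
  obtain ⟨n, hn⟩ := hN
  have hK := hM.extVanish_of_eventually hAC (N := LinearMap.ker p) ⟨n + 1, fun j hj => by
    obtain ⟨j, rfl⟩ : ∃ l, j = l + 1 := ⟨j - 1, by omega⟩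
    exact ExtVanish.right₁ (Submodule.injective_subtype _) p.exact_subtype_ker_map hp
        (hn j (by omega)) (hM.extVanish_projective j)⟩ 0
  obtain ⟨ψ, hψ⟩ := ExtVanish.exists_lift (Submodule.injective_subtype _)
    p.exact_subtype_ker_map hp hK g
  exact ⟨_, _, _, inferInstance, ψ, p, hψ⟩

end IsExtAcyclic

end StableVanishing

section DualClass

variable {R : Type u} [CommRing R]

section

variable {A B C A' B' C' : Type u} [AddCommGroup A] [Module R A] [AddCommGroup B] [Module R B]
  [AddCommGroup C] [Module R C] [AddCommGroup A'] [Module R A'] [AddCommGroup B'] [Module R B']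
  [AddCommGroup C'] [Module R C']

theorem Module.Projective.ker_of_surjective [Module.Projective R A] [Module.Projective R B]
    {p : A →ₗ[R] B} (hp : Function.Surjective p) : Module.Projective R (LinearMap.ker p) := by
  obtain ⟨s, hs⟩ := Module.projective_lifting_property p LinearMap.id hp
  have h : ∀ a, p (s a) = a := LinearMap.congr_fun hs
  refine Module.Projective.of_split (LinearMap.ker p).subtype
    ((LinearMap.id - s ∘ₗ p).codRestrict (LinearMap.ker p) fun a => by simp [h]) ?_
  ext ⟨a, ha⟩
  simp [LinearMap.mem_ker.1 ha]

/-- A morphism of short exact sequences whose left component is surjective induces a short exact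
sequence of kernels. -/
theorem exists_shortExact_ker {f : A →ₗ[R] B} {g : B →ₗ[R] C} {f' : A' →ₗ[R] B'}
    {g' : B' →ₗ[R] C'} (hf : Function.Injective f) (hfg : Function.Exact f g)
    (hf' : Function.Injective f') (hfg' : Function.Exact f' g') (hg' : Function.Surjective g')
    {a : A' →ₗ[R] A} {b : B' →ₗ[R] B} {c : C' →ₗ[R] C} (hab : b ∘ₗ f' = f ∘ₗ a)
    (hbc : c ∘ₗ g' = g ∘ₗ b) (ha : Function.Surjective a) :
    ∃ (i : LinearMap.ker a →ₗ[R] LinearMap.ker b) (p : LinearMap.ker b →ₗ[R] LinearMap.ker c),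
      Function.Injective i ∧ Function.Exact i p ∧ Function.Surjective p := by
  have hab : ∀ x, b (f' x) = f (a x) := LinearMap.congr_fun hab
  have hbc : ∀ x, c (g' x) = g (b x) := LinearMap.congr_fun hbc
  have hi : ∀ x ∈ LinearMap.ker a, f' x ∈ LinearMap.ker b := fun x hx => by
    simp_all [LinearMap.mem_ker]
  have hp : ∀ x ∈ LinearMap.ker b, g' x ∈ LinearMap.ker c := fun x hx => by
    simp_all [LinearMap.mem_ker]
  refine ⟨f'.restrict hi, g'.restrict hp, ?_, ?_, ?_⟩
  · intro x y hxy
    exact Subtype.ext (hf' (congrArg Subtype.val hxy))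
  · intro y
    constructor
    · intro hy
      obtain ⟨x, hx⟩ := (hfg' y).1 (congrArg Subtype.val hy)
      refine ⟨⟨x, ?_⟩, Subtype.ext hx⟩
      apply hf
      rw [← hab, hx, map_zero]
      exact y.2
    · rintro ⟨x, rfl⟩
      exact Subtype.ext ((hfg' _).2 ⟨x, rfl⟩)
  · intro z
    obtain ⟨y, hy⟩ := hg' z
    obtain ⟨x, hx⟩ := (hfg (b y)).1 (by rw [← hbc, hy]; exact z.2)
    obtain ⟨w, rfl⟩ := ha x
    refine ⟨⟨y - f' w, ?_⟩, Subtype.ext ?_⟩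
    · simp [hab, hx]
    · have : g' (f' w) = 0 := (hfg' _).2 ⟨w, rfl⟩
      simp [hy, this]

end

variable (E : Type u) [AddCommGroup E] [Module R E]

/-- The closure, under extensions and syzygies, of the modules `Hom_R(X, E)` with `X` finitely
generated and annihilated by `I`. -/
inductive DualClass (I : Ideal R) : ∀ (N : Type u) [AddCommGroup N] [Module R N], Prop
  | dual {X N : Type u} [AddCommGroup X] [Module R X] [AddCommGroup N] [Module R N]
      (hfin : Module.Finite R X) (hX : I ≤ Module.annihilator R X) (e : N ≃ₗ[R] (X →ₗ[R] E)) :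
      DualClass I N
  | ext {A B C : Type u} [AddCommGroup A] [Module R A] [AddCommGroup B] [Module R B]
      [AddCommGroup C] [Module R C] {f : A →ₗ[R] B} {g : B →ₗ[R] C} (hf : Function.Injective f)
      (hfg : Function.Exact f g) (hg : Function.Surjective g) (hA : DualClass I A)
      (hC : DualClass I C) : DualClass I B
  | syz {A B C : Type u} [AddCommGroup A] [Module R A] [AddCommGroup B] [Module R B]
      [AddCommGroup C] [Module R C] {f : A →ₗ[R] B} {g : B →ₗ[R] C} (hf : Function.Injective f)
      (hfg : Function.Exact f g) (hg : Function.Surjective g) (hB : Module.Projective R B)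
      (hC : DualClass I C) : DualClass I A

variable {E}

/-- The map `N × P → N` given by multiplication by `x` on `N` and `π` on `P`. -/
def coneMap {N P : Type u} [AddCommGroup N] [Module R N] [AddCommGroup P] [Module R P] (x : R)
    (π : P →ₗ[R] N) : N × P →ₗ[R] N :=
  (x • LinearMap.id).coprod π

@[simp]
theorem coneMap_apply {N P : Type u} [AddCommGroup N] [Module R N] [AddCommGroup P] [Module R P]
    (x : R) (π : P →ₗ[R] N) (y : N × P) : coneMap x π y = x • y.1 + π y.2 := by
  simp [coneMap]

theorem exists_shortExact_ker_coneMap {A B C P Q : Type u} [AddCommGroup A] [Module R A]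
    [AddCommGroup B] [Module R B] [AddCommGroup C] [Module R C] [AddCommGroup P] [Module R P]
    [AddCommGroup Q] [Module R Q] [Module.Projective R Q] {f : A →ₗ[R] B} {g : B →ₗ[R] C}
    (hf : Function.Injective f) (hfg : Function.Exact f g) (hg : Function.Surjective g) (x : R)
    {π : P →ₗ[R] A} (hπ : Function.Surjective (coneMap x π)) {ρ : Q →ₗ[R] C}
    (hρ : Function.Surjective (coneMap x ρ)) :
    ∃ (τ : P × Q →ₗ[R] B) (i : LinearMap.ker (coneMap x π) →ₗ[R] LinearMap.ker (coneMap x τ))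
      (p : LinearMap.ker (coneMap x τ) →ₗ[R] LinearMap.ker (coneMap x ρ)),
      Function.Surjective (coneMap x τ) ∧
      Function.Injective i ∧ Function.Exact i p ∧ Function.Surjective p := by
  obtain ⟨ρ', hρ'⟩ := Module.projective_lifting_property g ρ hg
  have hρ' : ∀ q, g (ρ' q) = ρ q := LinearMap.congr_fun hρ'
  have hgf : ∀ a, g (f a) = 0 := fun a => (hfg _).2 ⟨a, rfl⟩
  let τ : P × Q →ₗ[R] B := (f ∘ₗ π).coprod ρ'
  let f' : A × P →ₗ[R] B × (P × Q) := f.prodMap (LinearMap.inl R P Q)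
  let g' : B × (P × Q) →ₗ[R] C × Q := g.prodMap (LinearMap.snd R P Q)
  have hab : coneMap x τ ∘ₗ f' = f ∘ₗ coneMap x π := by
    refine LinearMap.ext fun y => ?_
    simp [τ, f']
  have hbc : coneMap x ρ ∘ₗ g' = g ∘ₗ coneMap x τ := by
    refine LinearMap.ext fun y => ?_
    simp [τ, g', hρ', hgf]
  have hfg' : Function.Exact f' g' := by
    rintro ⟨b, p, q⟩
    simp only [f', g', LinearMap.prodMap_apply, LinearMap.snd_apply, LinearMap.inl_apply,
      Prod.mk_eq_zero, Set.mem_range, Prod.exists, Prod.mk.injEq]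
    constructor
    · rintro ⟨hb, rfl⟩
      obtain ⟨a, rfl⟩ := (hfg b).1 hb
      exact ⟨a, p, rfl, rfl, rfl⟩
    · rintro ⟨a, p, rfl, rfl, rfl⟩
      exact ⟨hgf a, rfl⟩
  have hf' : Function.Injective f' := hf.prodMap LinearMap.inl_injective
  have hg' : Function.Surjective g' := hg.prodMap Prod.snd_surjective
  obtain ⟨i, p, h₁, h₂, h₃⟩ := exists_shortExact_ker hf hfg hf' hfg' hg' hab hbc hπ
  refine ⟨τ, i, p, fun b => ?_, h₁, h₂, h₃⟩
  obtain ⟨y, hy⟩ := hρ (g b)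
  obtain ⟨z, rfl⟩ := hg' y
  have hz : g (b - coneMap x τ z) = 0 := by
    rw [map_sub, ← hy, sub_eq_zero]
    exact LinearMap.congr_fun hbc z
  obtain ⟨a, ha⟩ := (hfg _).1 hz
  obtain ⟨w, rfl⟩ := hπ a
  refine ⟨z + f' w, ?_⟩
  have := LinearMap.congr_fun hab w
  simp only [LinearMap.comp_apply] at this
  rw [map_add, this, ha]
  abel

namespace DualClass

theorem exists_cone_dual [Module.Injective R E] {I : Ideal R} {X N : Type u} [AddCommGroup X]
    [Module R X] [AddCommGroup N] [Module R N] [IsNoetherianRing R] [Module.Finite R X]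
    (hX : I ≤ Module.annihilator R X) (e : N ≃ₗ[R] (X →ₗ[R] E)) (x : R) :
    ∃ (P : Type u) (_ : AddCommGroup P) (_ : Module R P) (π : P →ₗ[R] N),
      Module.Projective R P ∧ Function.Surjective (coneMap x π) ∧
      DualClass E (I ⊔ Ideal.span {x}) (LinearMap.ker (coneMap x π)) := by
  let t : X →ₗ[R] X := x • LinearMap.id
  let X' := LinearMap.ker t
  have hX' : ∀ y : X', x • (y : X) = 0 := fun y => y.2
  let ρ : N →ₗ[R] (X' →ₗ[R] E) := LinearMap.lcomp R E X'.subtype ∘ₗ e.toLinearMap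
  have hρ_apply : ∀ n (y : X'), ρ n y = e n y := fun n y => rfl
  have hρ : Function.Surjective ρ := by
    intro φ
    obtain ⟨ψ, hψ⟩ := Module.Injective.out X'.subtype X'.injective_subtype φ
    refine ⟨e.symm ψ, LinearMap.ext fun y => ?_⟩
    simpa [hρ_apply] using hψ y
  have hρx : ∀ n, ρ (x • n) = 0 := fun n => LinearMap.ext fun y => by
    rw [hρ_apply, map_smul, LinearMap.smul_apply, ← map_smul, hX' y]; simp
  have hρker : ∀ n, ρ n = 0 → ∃ n', x • n' = n := by
    intro n hn
    have hle : X' ≤ LinearMap.ker (e n) := fun y hy => LinearMap.congr_fun hn ⟨y, hy⟩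
    obtain ⟨ψ, hψ⟩ := Module.Injective.out (X'.liftQ t le_rfl)
      (LinearMap.ker_eq_bot.1 (Submodule.ker_liftQ_eq_bot _ _ _ le_rfl)) (X'.liftQ (e n) hle)
    refine ⟨e.symm ψ, e.injective (LinearMap.ext fun y => ?_)⟩
    have := hψ (X'.mkQ y)
    simp only [Submodule.mkQ_apply, Submodule.liftQ_apply] at this
    simp [← this, t]
  let P := (X' →ₗ[R] E) →₀ R
  let p : P →ₗ[R] (X' →ₗ[R] E) := Finsupp.linearCombination R id
  have hp : Function.Surjective p := Finsupp.linearCombination_id_surjective R _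
  obtain ⟨π, hπ⟩ := Module.projective_lifting_property ρ p hρ
  have hπ : ∀ q, ρ (π q) = p q := LinearMap.congr_fun hπ
  refine ⟨P, _, _, π, inferInstance, ?_, ?_⟩
  · intro n
    obtain ⟨q, hq⟩ := hp (ρ n)
    obtain ⟨n', hn'⟩ := hρker (n - π q) (by rw [map_sub, hπ, hq, sub_self])
    exact ⟨(n', q), by simp [hn']⟩
  let K := LinearMap.ker (x • LinearMap.id : N →ₗ[R] N)
  let f : K →ₗ[R] LinearMap.ker (coneMap x π) :=
    (LinearMap.inl R N P).restrict fun n hn => by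
      have : x • n = 0 := hn
      simp [this]
  let g : LinearMap.ker (coneMap x π) →ₗ[R] LinearMap.ker p :=
    (LinearMap.snd R N P).restrict fun y hy => by
      have hy : x • y.1 + π y.2 = 0 := by simpa using hy
      have := congrArg ρ hy
      rw [map_add, hρx, hπ, zero_add, map_zero] at this
      exact this
  have hf : Function.Injective f := fun a b hab =>
    Subtype.ext (congrArg (fun y => (Subtype.val y).1) hab)
  have hfg : Function.Exact f g := by
    rintro ⟨⟨n, q⟩, hy⟩
    constructor
    · intro h
      obtain rfl : q = 0 := congrArg Subtype.val h
      exact ⟨⟨n, by simpa [K] using hy⟩, rfl⟩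
    · rintro ⟨k, hk⟩
      have : (0 : P) = q := congrArg (fun y => (Subtype.val y).2) hk
      exact Subtype.ext this.symm
  have hg : Function.Surjective g := by
    rintro ⟨q, hq⟩
    obtain ⟨n, hn⟩ := hρker (-π q) (by rw [map_neg, hπ, LinearMap.mem_ker.1 hq, neg_zero])
    exact ⟨⟨(n, q), by simp [hn]⟩, rfl⟩
  have hann : ∀ (Y : Type u) [AddCommGroup Y] [Module R Y], I ≤ Module.annihilator R Y →
      (∀ y : Y, x • y = 0) → I ⊔ Ideal.span {x} ≤ Module.annihilator R Y := by
    intro Y _ _ h₁ h₂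
    refine sup_le h₁ ?_
    rw [Ideal.span_singleton_le_iff_mem, Module.mem_annihilator]
    exact h₂
  refine ext (A := K) (B := LinearMap.ker (coneMap x π)) (C := LinearMap.ker p) (f := f) (g := g)
    hf hfg hg ?_ ?_
  · let Y := X ⧸ LinearMap.range t
    have hY : ∀ y : Y, x • y = 0 := by
      intro y
      obtain ⟨y, rfl⟩ := Submodule.mkQ_surjective _ y
      rw [← map_smul]
      exact (Submodule.Quotient.mk_eq_zero _).2 ⟨y, rfl⟩
    let u : (Y →ₗ[R] E) →ₗ[R] K :=
      (e.symm.toLinearMap ∘ₗ LinearMap.lcomp R E (LinearMap.range t).mkQ).codRestrict K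
        fun φ => by
          change x • e.symm _ = 0
          rw [← map_smul, ← map_smul]
          have : x • φ = 0 := LinearMap.ext fun y => by
            rw [LinearMap.smul_apply, ← map_smul, hY]; simp
          simp [this]
    have hu : Function.Bijective u := by
      constructor
      · intro φ ψ h
        have := e.symm.injective (congrArg Subtype.val h)
        exact LinearMap.cancel_right (Submodule.mkQ_surjective _) |>.1 this
      · rintro ⟨n, hn⟩
        have hn : x • n = 0 := hn
        have hle : LinearMap.range t ≤ LinearMap.ker (e n) := by
          rintro _ ⟨y, rfl⟩
          change e n (x • y) = 0
          rw [map_smul, ← LinearMap.smul_apply, ← map_smul, hn]; simp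
        refine ⟨(LinearMap.range t).liftQ (e n) hle, Subtype.ext (e.injective ?_)⟩
        change e (e.symm (LinearMap.lcomp R E (LinearMap.range t).mkQ _)) = e n
        rw [e.apply_symm_apply]
        rfl
    exact dual (X := Y) inferInstance (hann _ (hX.trans
      (LinearMap.annihilator_le_of_surjective _ (Submodule.mkQ_surjective _))) hY)
      (LinearEquiv.ofBijective u hu).symm
  · exact syz (Submodule.injective_subtype _) p.exact_subtype_ker_map hp inferInstance
      (dual (X := X') inferInstance (hann _ (hX.trans
        (LinearMap.annihilator_le_of_injective _ X'.injective_subtype))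
          fun y => Subtype.ext (hX' y)) (LinearEquiv.refl _ _))

theorem exists_cone [Module.Injective R E] [IsNoetherianRing R] {I : Ideal R} {N : Type u}
    [AddCommGroup N] [Module R N] (hN : DualClass E I N) (x : R) :
    ∃ (P : Type u) (_ : AddCommGroup P) (_ : Module R P) (π : P →ₗ[R] N),
      Module.Projective R P ∧ Function.Surjective (coneMap x π) ∧
      DualClass E (I ⊔ Ideal.span {x}) (LinearMap.ker (coneMap x π)) := by
  induction hN with
  | dual hfin hX e => exact exists_cone_dual hX e x
  | ext hf hfg hg _ _ ihA ihC =>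
    obtain ⟨P, _, _, π, _, hπ, hP⟩ := ihA
    obtain ⟨Q, _, _, ρ, _, hρ, hQ⟩ := ihC
    obtain ⟨τ, i, p, hτ, h₁, h₂, h₃⟩ := exists_shortExact_ker_coneMap hf hfg hg x hπ hρ
    exact ⟨_, _, _, τ, inferInstance, hτ, ext h₁ h₂ h₃ hP hQ⟩
  | @syz A B C _ _ _ _ _ _ f g hf hfg hg hB _ ihC =>
    obtain ⟨Q, _, _, ρ, _, hρ, hQ⟩ := ihC
    have hπ : Function.Surjective (coneMap x (Finsupp.linearCombination R (id : A → A))) := by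
      intro a
      obtain ⟨q, hq⟩ := Finsupp.linearCombination_id_surjective R A a
      exact ⟨(0, q), by simpa using hq⟩
    obtain ⟨τ, i, p, hτ, h₁, h₂, h₃⟩ := exists_shortExact_ker_coneMap hf hfg hg x hπ hρ
    exact ⟨_, _, _, _, inferInstance, hπ,
      syz h₁ h₂ h₃ (Module.Projective.ker_of_surjective hτ) hQ⟩

end DualClass

end DualClass

section StablyFinite

variable {R : Type u} [CommRing R]

theorem exists_desc {A B L : Type u} [AddCommGroup A] [Module R A] [AddCommGroup B] [Module R B]
    [AddCommGroup L] [Module R L] {p : A →ₗ[R] B} (hp : Function.Surjective p) (u : A →ₗ[R] L)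
    (hle : LinearMap.ker p ≤ LinearMap.ker u) : ∃ D : B →ₗ[R] L, ∀ a, D (p a) = u a := by
  refine ⟨(LinearMap.ker p).liftQ u hle ∘ₗ (p.quotKerEquivOfSurjective hp).symm.toLinearMap,
    fun a => ?_⟩
  have : (p.quotKerEquivOfSurjective hp).symm (p a) = Submodule.Quotient.mk a := by
    rw [LinearEquiv.symm_apply_eq]
    rfl
  rw [LinearMap.comp_apply, LinearEquiv.coe_coe, this, Submodule.liftQ_apply]

variable (R) in
/-- A module is stably finite if, up to adding projective summands, it is finitely generated. -/
def StablyFinite (N : Type u) [AddCommGroup N] [Module R N] : Prop :=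
  ∃ (P L : Type u) (_ : AddCommGroup P) (_ : Module R P) (_ : AddCommGroup L) (_ : Module R L)
    (c : N × P →ₗ[R] L), Module.Projective R P ∧ Module.Projective R L ∧
      Function.Surjective c ∧ (LinearMap.ker c).FG

namespace StablyFinite

variable {A B C N P : Type u} [AddCommGroup A] [Module R A] [AddCommGroup B] [Module R B]
  [AddCommGroup C] [Module R C] [AddCommGroup N] [Module R N] [AddCommGroup P] [Module R P]

theorem of_finite [Module.Finite R N] [IsNoetherianRing R] : StablyFinite R N :=
  ⟨PUnit, PUnit, _, _, _, _, 0, inferInstance, inferInstance, fun _ => ⟨0, rfl⟩,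
    IsNoetherian.noetherian _⟩

theorem of_prod_projective [Module.Projective R P] (h : StablyFinite R (N × P)) :
    StablyFinite R N := by
  obtain ⟨Q, L, _, _, _, _, c, _, hL, hc, hfg⟩ := h
  let e := (LinearEquiv.prodAssoc R N P Q).symm
  refine ⟨P × Q, L, _, _, _, _, c ∘ₗ e.toLinearMap, inferInstance, hL,
    hc.comp e.surjective, ?_⟩
  rw [LinearMap.ker_comp]
  have : (LinearMap.ker c).comap e.toLinearMap = (LinearMap.ker c).map e.symm.toLinearMap :=
    (Submodule.map_equiv_eq_comap_symm e.symm _).symm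
  rw [this]
  exact hfg.map _

theorem of_ker [Module.Projective R P] {d : N →ₗ[R] P} (hd : Function.Surjective d)
    (h : StablyFinite R (LinearMap.ker d)) : StablyFinite R N := by
  obtain ⟨Q, L, _, _, _, _, c, _, _, hc, hfg⟩ := h
  obtain ⟨s, hs⟩ := Module.projective_lifting_property d LinearMap.id hd
  have hs : ∀ x, d (s x) = x := LinearMap.congr_fun hs
  let r : N →ₗ[R] LinearMap.ker d :=
    (LinearMap.id - s ∘ₗ d).codRestrict _ fun x => by simp [hs]
  have hr : ∀ k : LinearMap.ker d, r k = k := fun k => Subtype.ext (by simp [r])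
  have hrs : ∀ x, r (s x) = 0 := fun x => Subtype.ext (by simp [r, hs])
  let D : N × Q →ₗ[R] L × P :=
    (c ∘ₗ r.prodMap LinearMap.id).prod (d ∘ₗ LinearMap.fst R N Q)
  refine ⟨Q, L × P, _, _, _, _, D, inferInstance, inferInstance, ?_, ?_⟩
  · rintro ⟨l, x⟩
    obtain ⟨⟨k, q⟩, rfl⟩ := hc l
    refine ⟨(k + s x, q), ?_⟩
    simp [D, hr, hrs, hs]
  · have : LinearMap.ker D =
        (LinearMap.ker c).map ((LinearMap.ker d).subtype.prodMap LinearMap.id) := by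
      ext ⟨n, q⟩
      simp only [D, LinearMap.mem_ker, LinearMap.prod_apply, Function.prod_apply,
        LinearMap.comp_apply, LinearMap.prodMap_apply, LinearMap.fst_apply, LinearMap.id_apply,
        Prod.mk_eq_zero, Submodule.mem_map]
      constructor
      · rintro ⟨h₁, h₂⟩
        have := hr ⟨n, h₂⟩
        exact ⟨(r n, q), h₁, Prod.ext (congrArg Subtype.val this) rfl⟩
      · rintro ⟨⟨k, q⟩, hk, h⟩
        obtain ⟨rfl, rfl⟩ := Prod.mk.inj h
        exact ⟨by simpa [hr] using hk, k.2⟩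
    rw [this]
    exact hfg.map _

theorem exists_finsupp (h : StablyFinite R N) :
    ∃ (P ι : Type u) (_ : AddCommGroup P) (_ : Module R P) (c : N × P →ₗ[R] ι →₀ R),
      Module.Projective R P ∧ Function.Surjective c ∧ (LinearMap.ker c).FG := by
  obtain ⟨P, L, _, _, _, _, c, _, _, hc, hfg⟩ := h
  let p : (L →₀ R) →ₗ[R] L := Finsupp.linearCombination R id
  have hp : Function.Surjective p := Finsupp.linearCombination_id_surjective R _
  obtain ⟨s, hs⟩ := Module.projective_lifting_property p LinearMap.id hp
  have hs : ∀ x, p (s x) = x := LinearMap.congr_fun hs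
  let Q := LinearMap.ker p
  have hQ : Module.Projective R Q := Module.Projective.ker_of_surjective hp
  let c' : N × (P × Q) →ₗ[R] L →₀ R :=
    (s ∘ₗ c).coprod Q.subtype ∘ₗ (LinearEquiv.prodAssoc R N P Q).symm.toLinearMap
  have hc' : ∀ n x q, c' (n, x, q) = s (c (n, x)) + q := fun n x q => rfl
  refine ⟨P × Q, L, inferInstance, inferInstance, c', inferInstance, fun l => ?_, ?_⟩
  · obtain ⟨⟨n, x⟩, hn⟩ := hc (p l)
    refine ⟨(n, x, ⟨l - s (p l), by simp [Q, hs]⟩), ?_⟩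
    rw [hc', hn]
    simp
  · have : LinearMap.ker c' = (LinearMap.ker c).map
        (LinearMap.id.prodMap (LinearMap.inl R P Q)) := by
      ext ⟨n, x, q⟩
      simp only [LinearMap.mem_ker, hc', Submodule.mem_map]
      constructor
      · intro h
        have h₁ := congrArg p h
        rw [map_add, hs, LinearMap.mem_ker.1 q.2, add_zero, map_zero] at h₁
        rw [h₁, map_zero, zero_add] at h
        refine ⟨(n, x), h₁, ?_⟩
        rw [← Subtype.ext (a1 := (0 : Q)) (a2 := q) h.symm]
        rfl
      · rintro ⟨⟨n', x'⟩, h₁, h₂⟩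
        have h₃ : (n', x', (0 : Q)) = (n, x, q) := h₂
        simp only [Prod.mk.injEq] at h₃
        obtain ⟨rfl, rfl, rfl⟩ := h₃
        simp [LinearMap.mem_ker.1 h₁]
    rw [this]
    exact hfg.map _

theorem of_shortExact_of_finite [IsNoetherianRing R] {f : A →ₗ[R] B} {g : B →ₗ[R] C}
    (hf : Function.Injective f) (hfg : Function.Exact f g) (hg : Function.Surjective g)
    (hA : StablyFinite R A) [Module.Finite R C] : StablyFinite R B := by
  obtain ⟨P, ι, _, _, c, _, hc, hfgc⟩ := hA.exists_finsupp
  obtain ⟨n, q, hq⟩ := Module.Finite.exists_fin' R C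
  obtain ⟨h, hh⟩ := Module.projective_lifting_property g q hg
  have hh : ∀ y, g (h y) = q y := LinearMap.congr_fun hh
  have hgf : ∀ a, g (f a) = 0 := fun a => (hfg _).2 ⟨a, rfl⟩
  let w : A × (Fin n → R) →ₗ[R] B := f.coprod h
  have hw : Function.Surjective w := by
    intro b
    obtain ⟨y, hy⟩ := hq (g b)
    obtain ⟨a, ha⟩ := (hfg (b - h y)).1 (by rw [map_sub, hh, hy, sub_self])
    exact ⟨(a, y), by simp [w, ha]⟩
  let v : LinearMap.ker w →ₗ[R] ι →₀ R :=
    c ∘ₗ LinearMap.inl R A P ∘ₗ LinearMap.fst R A (Fin n → R) ∘ₗ (LinearMap.ker w).subtype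
  have hinj : Function.Injective (LinearMap.snd R A (Fin n → R) ∘ₗ (LinearMap.ker w).subtype) := by
    rw [← LinearMap.ker_eq_bot, LinearMap.ker_eq_bot']
    rintro ⟨⟨a, y⟩, hay⟩ h0
    obtain rfl : y = 0 := h0
    have : f a = 0 := by simpa [w] using hay
    rw [map_eq_zero_iff f hf] at this
    exact Subtype.ext (Prod.ext this rfl)
  have hfin : Module.Finite R (LinearMap.ker w) := Module.Finite.of_injective _ hinj
  obtain ⟨t, ht⟩ := exists_finset_forall_mem_supported v
  let L := (t : Set ι)ᶜ.Elem →₀ R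
  let r : (ι →₀ R) →ₗ[R] L := Finsupp.lsubtypeDomain _
  have hr : Function.Surjective r := fun l =>
    ⟨l.embDomain (Function.Embedding.subtype _), Finsupp.ext fun x => by
      exact Finsupp.embDomain_apply_self _ _ _⟩
  have hrker : LinearMap.ker r = Finsupp.supported R R (t : Set ι) := by
    ext y
    rw [LinearMap.mem_ker, Finsupp.mem_supported']
    constructor
    · intro hy x hx
      exact DFunLike.congr_fun hy ⟨x, hx⟩
    · intro hy
      exact Finsupp.ext fun x => hy x x.2
  have hκ : (LinearMap.ker (r ∘ₗ c)).FG := by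
    refine Submodule.fg_of_fg_map_of_fg_inf_ker c ?_ ?_
    · have : (LinearMap.ker (r ∘ₗ c)).map c = Finsupp.supported R R (t : Set ι) := by
        rw [LinearMap.ker_comp, Submodule.map_comap_eq_of_surjective hc, hrker]
      rw [this, ← Module.Finite.iff_fg]
      exact Module.Finite.equiv (Finsupp.supportedEquivFinsupp (R := R) (M := R) (t : Set ι)).symm
    · rwa [inf_eq_right.2]
      rw [LinearMap.ker_comp]
      exact fun x hx => by
        rw [Submodule.mem_comap, LinearMap.mem_ker.1 hx]; exact zero_mem _
  have hwP : Function.Surjective (w.prodMap (LinearMap.id : P →ₗ[R] P)) :=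
    hw.prodMap Function.surjective_id
  let u : (A × (Fin n → R)) × P →ₗ[R] L :=
    (r ∘ₗ c) ∘ₗ (LinearMap.fst R A (Fin n → R)).prodMap LinearMap.id
  have hle : LinearMap.ker (w.prodMap (LinearMap.id : P →ₗ[R] P)) ≤ LinearMap.ker u := by
    rintro ⟨k, x⟩ hx
    obtain ⟨hk, rfl⟩ : w k = 0 ∧ x = 0 := by simpa using hx
    have : v ⟨k, hk⟩ ∈ LinearMap.ker r := hrker ▸ ht ⟨k, hk⟩
    exact this
  obtain ⟨D, hDw⟩ := exists_desc hwP u hle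
  have hDf : ∀ a x, D (f a, x) = r (c (a, x)) := by
    intro a x
    have := hDw ((a, 0), x)
    simpa [w, u] using this
  refine ⟨P, L, _, _, _, _, D, inferInstance, inferInstance, fun l => ?_, ?_⟩
  · obtain ⟨⟨a, x⟩, hax⟩ := (hr.comp hc) l
    exact ⟨(f a, x), (hDf a x).trans hax⟩
  · refine Submodule.fg_of_fg_map_of_fg_inf_ker (g ∘ₗ LinearMap.fst R B P)
      (IsNoetherian.noetherian _) ?_
    have : LinearMap.ker D ⊓ LinearMap.ker (g ∘ₗ LinearMap.fst R B P) =
        (LinearMap.ker (r ∘ₗ c)).map (f.prodMap LinearMap.id) := by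
      ext ⟨b, x⟩
      simp only [Submodule.mem_inf, LinearMap.mem_ker, Submodule.mem_map, LinearMap.comp_apply,
        LinearMap.fst_apply, Prod.exists, LinearMap.prodMap_apply, LinearMap.id_apply,
        Prod.mk.injEq]
      constructor
      · rintro ⟨h₁, h₂⟩
        obtain ⟨a, rfl⟩ := (hfg b).1 h₂
        exact ⟨a, x, (hDf a x).symm.trans h₁, rfl, rfl⟩
      · rintro ⟨a, x, h₁, rfl, rfl⟩
        exact ⟨(hDf a x).trans h₁, hgf a⟩
    rw [this]
    exact hκ.map _

theorem of_shortExact [IsNoetherianRing R] {f : A →ₗ[R] B} {g : B →ₗ[R] C}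
    (hf : Function.Injective f) (hfg : Function.Exact f g) (hg : Function.Surjective g)
    (hA : StablyFinite R A) (hC : StablyFinite R C) : StablyFinite R B := by
  obtain ⟨P, L, _, _, _, _, c, _, _, hc, hfgc⟩ := hC
  have hgf : ∀ a, g (f a) = 0 := fun a => (hfg _).2 ⟨a, rfl⟩
  let G : B × P →ₗ[R] C × P := g.prodMap LinearMap.id
  have hG : Function.Surjective G := hg.prodMap Function.surjective_id
  let i : A →ₗ[R] LinearMap.ker (c ∘ₗ G) :=
    (LinearMap.inl R B P ∘ₗ f).codRestrict _ fun a => by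
      rw [LinearMap.mem_ker, LinearMap.comp_apply, LinearMap.comp_apply]
      simp only [G, LinearMap.inl_apply, LinearMap.prodMap_apply, hgf, map_zero]
      exact map_zero c
  let p : LinearMap.ker (c ∘ₗ G) →ₗ[R] LinearMap.ker c := G.restrict fun x hx => hx
  have hi : Function.Injective i := fun a b hab =>
    hf (congrArg (fun y => (Subtype.val y).1) hab)
  have hip : Function.Exact i p := by
    rintro ⟨⟨b, x⟩, hx⟩
    constructor
    · intro h
      obtain ⟨hb, rfl⟩ := Prod.mk.inj (congrArg Subtype.val h)
      obtain ⟨a, rfl⟩ := (hfg b).1 hb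
      exact ⟨a, rfl⟩
    · rintro ⟨a, ha⟩
      obtain ⟨rfl, rfl⟩ := Prod.mk.inj (congrArg Subtype.val ha)
      exact Subtype.ext (Prod.ext (hgf a) rfl)
  have hp : Function.Surjective p := by
    rintro ⟨y, hy⟩
    obtain ⟨x, rfl⟩ := hG y
    exact ⟨⟨x, hy⟩, rfl⟩
  have : Module.Finite R (LinearMap.ker c) := Module.Finite.iff_fg.2 hfgc
  exact ((hA.of_shortExact_of_finite hi hip hp).of_ker (d := c ∘ₗ G)
    (hc.comp hG)).of_prod_projective

theorem syzygy [IsNoetherianRing R] {f : A →ₗ[R] B} {g : B →ₗ[R] C}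
    (hf : Function.Injective f) (hfg : Function.Exact f g) (hg : Function.Surjective g)
    [Module.Projective R B] (hC : StablyFinite R C) : StablyFinite R A := by
  obtain ⟨P, L, _, _, _, _, c, _, _, hc, hfgc⟩ := hC
  have hgf : ∀ a, g (f a) = 0 := fun a => (hfg _).2 ⟨a, rfl⟩
  let G : B × P →ₗ[R] C × P := g.prodMap LinearMap.id
  have hG : Function.Surjective G := hg.prodMap Function.surjective_id
  obtain ⟨n, q, hq⟩ := (Submodule.fg_iff_exists_fin_linearMap _ _).1 hfgc
  obtain ⟨h, hh⟩ := Module.projective_lifting_property G q hG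
  have hh : ∀ y, G (h y) = q y := LinearMap.congr_fun hh
  have hcq : ∀ y, c (q y) = 0 := fun y => by
    have : q y ∈ LinearMap.range q := ⟨y, rfl⟩
    rwa [hq] at this
  have hGf : ∀ a, G (f a, 0) = 0 := fun a => by simp [G, hgf]
  let D : A × (Fin n → R) →ₗ[R] LinearMap.ker (c ∘ₗ G) :=
    ((LinearMap.inl R B P ∘ₗ f).coprod h).codRestrict _ fun x => by
      simp only [LinearMap.coprod_apply, LinearMap.mem_ker, LinearMap.comp_apply, map_add, hh, hcq,
        LinearMap.inl_apply, hGf, map_zero, add_zero]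
  have hD : ∀ a y, (D (a, y) : B × P) = (f a, 0) + h y := fun a y => rfl
  have : Module.Projective R (LinearMap.ker (c ∘ₗ G)) :=
    Module.Projective.ker_of_surjective (p := c ∘ₗ G) (hc.comp hG)
  refine ⟨Fin n → R, LinearMap.ker (c ∘ₗ G), _, _, _, _, D, inferInstance, inferInstance, ?_, ?_⟩
  · rintro ⟨k, hk⟩
    have : G k ∈ LinearMap.range q := hq ▸ hk
    obtain ⟨y, hy⟩ := this
    have h0 : G (k - h y) = 0 := by rw [map_sub, hh, hy, sub_self]
    obtain ⟨h₁, h₂⟩ := Prod.mk.inj h0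
    obtain ⟨a, ha⟩ := (hfg _).1 h₁
    refine ⟨(a, y), Subtype.ext ?_⟩
    rw [hD]
    have : ((f a, 0) : B × P) = k - h y := Prod.ext ha h₂.symm
    rw [this, sub_add_cancel]
  · rw [← Module.Finite.iff_fg]
    refine Module.Finite.of_injective
      (LinearMap.snd R A (Fin n → R) ∘ₗ (LinearMap.ker D).subtype) ?_
    rw [← LinearMap.ker_eq_bot, LinearMap.ker_eq_bot']
    rintro ⟨⟨a, y⟩, hay⟩ h0
    obtain rfl : y = 0 := h0
    have h₁ := hD a 0
    rw [LinearMap.mem_ker.1 hay, map_zero, add_zero] at h₁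
    have h₂ : f a = 0 := (congrArg Prod.fst h₁).symm
    rw [map_eq_zero_iff f hf] at h₂
    exact Subtype.ext (Prod.ext h₂ rfl)

theorem stablyZero [IsNoetherianRing R] (hAC : SatisfiesAC R) {M : Type u} [AddCommGroup M]
    [Module R M] (hM : IsExtAcyclic R M) (hN : StablyFinite R N)
    (hMN : ∃ n, ∀ i ≥ n, ExtVanish R M N i) (g : M →ₗ[R] N) : StablyZero g := by
  obtain ⟨P, L, _, _, _, _, c, _, _, hc, hfgc⟩ := hN
  obtain ⟨s, hs⟩ := Module.projective_lifting_property c LinearMap.id hc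
  have hs : ∀ x, c (s x) = x := LinearMap.congr_fun hs
  obtain ⟨n, hn⟩ := hMN
  have : Module.Finite R (LinearMap.ker c) := Module.Finite.iff_fg.2 hfgc
  have hT := hM.stablyZero_of_finite hAC (N := LinearMap.ker c) ⟨n + 2, fun j hj => by
    obtain ⟨j, rfl⟩ : ∃ l, j = l + 2 := ⟨j - 2, by omega⟩
    exact ExtVanish.right₁ (Submodule.injective_subtype _) c.exact_subtype_ker_map hc
      (hM.extVanish_projective j) ((hn _ (by omega)).prod (hM.extVanish_projective _))⟩
    (((LinearMap.id - s ∘ₗ c) ∘ₗ LinearMap.inl R N P ∘ₗ g).codRestrict _ fun x => by simp [hs])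
  have hL := StablyZero.of_projective_target (c ∘ₗ LinearMap.inl R N P ∘ₗ g)
  have := ((hT.comp_left (LinearMap.ker c).subtype).add (hL.comp_left s)).comp_left
    (LinearMap.fst R N P)
  convert this using 1
  refine LinearMap.ext fun x => ?_
  change g x = (((g x, (0 : P)) - s (c (g x, 0))) + s (c (g x, 0))).1
  rw [sub_add_cancel]

end StablyFinite

theorem DualClass.stablyFinite [IsNoetherianRing R] {E : Type u} [AddCommGroup E] [Module R E]
    {I : Ideal R} {N : Type u} [AddCommGroup N] [Module R N] (hN : DualClass E I N)
    (hE : ∀ (X : Type u) [AddCommGroup X] [Module R X], Module.Finite R X →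
      I ≤ Module.annihilator R X → Module.Finite R (X →ₗ[R] E)) : StablyFinite R N := by
  induction hN with
  | dual hfin hX e =>
    have := hE _ hfin hX
    have := Module.Finite.equiv e.symm
    exact .of_finite
  | ext hf hfg hg _ _ ihA ihC => exact ihA.of_shortExact hf hfg hg ihC
  | syz hf hfg hg _ _ ihC => exact ihC.syzygy hf hfg hg

end StablyFinite

section StablyTorsion

variable {R : Type u} [CommRing R]

theorem StablyZero.exists_finite {M N : Type u} [AddCommGroup M] [Module R M] [AddCommGroup N]
    [Module R N] [Module.Finite R M] {g : M →ₗ[R] N} (hg : StablyZero g) :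
    ∃ (P : Type u) (_ : AddCommGroup P) (_ : Module R P) (a : M →ₗ[R] P) (b : P →ₗ[R] N),
      Module.Finite R P ∧ Module.Projective R P ∧ b ∘ₗ a = g := by
  obtain ⟨P, _, _, _, a, b, rfl⟩ := hg
  obtain ⟨s, hs⟩ := Module.projective_def'.1 ‹Module.Projective R P›
  obtain ⟨t, ht⟩ := exists_finset_forall_mem_supported (s ∘ₗ a)
  let e := Finsupp.supportedEquivFinsupp (R := R) (M := R) (t : Set P)
  have hproj : Module.Projective R (Finsupp.supported R R (t : Set P)) :=
    Module.Projective.of_equiv e.symm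
  refine ⟨Finsupp.supported R R (t : Set P), inferInstance, inferInstance,
    (s ∘ₗ a).codRestrict _ ht, b ∘ₗ Finsupp.linearCombination R id ∘ₗ Submodule.subtype _,
    Module.Finite.equiv e.symm, hproj, LinearMap.ext fun x => ?_⟩
  exact congrArg b (LinearMap.congr_fun hs (a x))

/-- Every map from a finitely generated module to `N` becomes stably zero after multiplication
by a power of `y`. -/
def StablyTorsion (y : R) (N : Type u) [AddCommGroup N] [Module R N] : Prop :=
  ∀ (M : Type u) [AddCommGroup M] [Module R M], Module.Finite R M →
    ∀ g : M →ₗ[R] N, ∃ n : ℕ, StablyZero (y ^ n • g)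

namespace StablyTorsion

variable {y : R} {N P B : Type u} [AddCommGroup N] [Module R N] [AddCommGroup P] [Module R P]
  [AddCommGroup B] [Module R B]

theorem of_torsion (h : ∀ e : N, ∃ n : ℕ, y ^ n • e = 0) : StablyTorsion y N := by
  intro M _ _ _ g
  obtain ⟨s, hs⟩ := Module.Finite.fg_top (R := R) (M := M)
  choose n hn using h
  refine ⟨s.sup fun x => n (g x), ?_⟩
  convert StablyZero.zero (R := R) (M := M) (N := N)
  rw [← LinearMap.ker_eq_top, eq_top_iff, ← hs, Submodule.span_le]
  intro x hx
  obtain ⟨k, hk⟩ := Nat.exists_eq_add_of_le' (Finset.le_sup (f := fun x => n (g x)) hx)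
  change y ^ _ • g x = 0
  rw [hk, pow_add, mul_smul, hn, smul_zero]

theorem prod_projective (h : StablyTorsion y N) [Module.Projective R P] :
    StablyTorsion y (N × P) := by
  intro M _ _ hM g
  obtain ⟨n, hn⟩ := h M hM (LinearMap.fst R N P ∘ₗ g)
  refine ⟨n, ?_⟩
  convert (hn.comp_left (LinearMap.inl R N P)).add ((StablyZero.of_projective_target
    (y ^ n • (LinearMap.snd R N P ∘ₗ g))).comp_left (LinearMap.inr R N P)) using 1
  refine LinearMap.ext fun x => Prod.ext ?_ ?_ <;> simp

theorem ker {p : B →ₗ[R] N} (hp : Function.Surjective p) (hB : StablyTorsion y B)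
    (hN : StablyTorsion y N) : StablyTorsion y (LinearMap.ker p) := by
  intro M _ _ hM g
  obtain ⟨n, hn⟩ := hB M hM ((LinearMap.ker p).subtype ∘ₗ g)
  obtain ⟨F, _, _, a, b, hF, _, hab⟩ := hn.exists_finite
  have hab : ∀ x, b (a x) = y ^ n • (g x : B) := LinearMap.congr_fun hab
  obtain ⟨m, P, _, _, _, c, d, hcd⟩ := hN (F ⧸ LinearMap.range a) inferInstance
    ((LinearMap.range a).liftQ (p ∘ₗ b) (by
      rintro _ ⟨x, rfl⟩
      rw [LinearMap.mem_ker, LinearMap.comp_apply, hab, map_smul, LinearMap.mem_ker.1 (g x).2,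
        smul_zero]))
  have hcd : ∀ x : F, d (c (Submodule.Quotient.mk x)) = y ^ m • p (b x) := fun x =>
    LinearMap.congr_fun hcd (Submodule.Quotient.mk x)
  obtain ⟨d', hd'⟩ := Module.projective_lifting_property p d hp
  have hd' : ∀ x, p (d' x) = d x := LinearMap.congr_fun hd'
  refine ⟨m + n, F, _, _, ‹_›, a, (y ^ m • b - d' ∘ₗ c ∘ₗ (LinearMap.range a).mkQ).codRestrict _
    fun x => ?_, LinearMap.ext fun x => Subtype.ext ?_⟩
  · simp [hd', hcd]
  · have : (Submodule.Quotient.mk (a x) : F ⧸ LinearMap.range a) = 0 :=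
      (Submodule.Quotient.mk_eq_zero _).2 ⟨x, rfl⟩
    change y ^ m • b (a x) - d' (c (Submodule.Quotient.mk (a x))) = y ^ (m + n) • (g x : B)
    rw [this, hab, map_zero, map_zero, sub_zero, pow_add, mul_smul]

end StablyTorsion

section

variable {M N P : Type u} [AddCommGroup M] [Module R M] [AddCommGroup N] [Module R N]
  [AddCommGroup P] [Module R P]

theorem StablyZero.of_smul {x : R} {π : P →ₗ[R] N} (hπ : Function.Surjective (coneMap x π))
    (hW : ∀ g : M →ₗ[R] LinearMap.ker (coneMap x π), StablyZero g) {g : M →ₗ[R] N}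
    (hg : StablyZero (x • g)) : StablyZero g := by
  obtain ⟨Q, _, _, _, a, b, hab⟩ := hg
  have hab : ∀ z, b (a z) = x • g z := LinearMap.congr_fun hab
  obtain ⟨b', hb'⟩ := Module.projective_lifting_property (coneMap x π) b hπ
  have hb' : ∀ z, coneMap x π (b' z) = b z := LinearMap.congr_fun hb'
  have h₁ := (hW ((LinearMap.inl R N P ∘ₗ g - b' ∘ₗ a).codRestrict _ fun z => by
    rw [LinearMap.mem_ker, LinearMap.sub_apply, map_sub, LinearMap.comp_apply b', hb', hab]
    simp)).comp_left (LinearMap.fst R N P ∘ₗ Submodule.subtype _)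
  have h₂ : StablyZero (LinearMap.fst R N P ∘ₗ b' ∘ₗ a) :=
    ⟨Q, _, _, ‹_›, a, LinearMap.fst R N P ∘ₗ b', rfl⟩
  convert h₁.add h₂ using 1
  refine LinearMap.ext fun z => ?_
  simp

theorem StablyZero.of_pow_smul {x : R} {π : P →ₗ[R] N} (hπ : Function.Surjective (coneMap x π))
    (hW : ∀ g : M →ₗ[R] LinearMap.ker (coneMap x π), StablyZero g) {g : M →ₗ[R] N} {n : ℕ}
    (hg : StablyZero (x ^ n • g)) : StablyZero g := by
  induction n with
  | zero => simpa using hg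
  | succ n ih => exact ih (.of_smul hπ hW (by rwa [pow_succ', mul_smul] at hg))

end

theorem DualClass.stablyZero [IsNoetherianRing R] (hAC : SatisfiesAC R) {M : Type u}
    [AddCommGroup M] [Module R M] (hM : IsExtAcyclic R M) {E : Type u} [AddCommGroup E]
    [Module R E] [Module.Injective R E] (l : List R) {I : Ideal R}
    (hE : ∀ (X : Type u) [AddCommGroup X] [Module R X], Module.Finite R X →
      I ⊔ Ideal.ofList l ≤ Module.annihilator R X → Module.Finite R (X →ₗ[R] E))
    {N : Type u} [AddCommGroup N] [Module R N] (hN : DualClass E I N)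
    (hl : ∀ y ∈ l, StablyTorsion y N) (hMN : ∃ n, ∀ i ≥ n, ExtVanish R M N i) (g : M →ₗ[R] N) :
    StablyZero g := by
  induction l generalizing I N with
  | nil =>
    rw [Ideal.ofList_nil, sup_bot_eq] at hE
    exact (hN.stablyFinite hE).stablyZero hAC hM hMN g
  | cons x l ih =>
    obtain ⟨P, _, _, π, _, hπ, hW⟩ := hN.exists_cone x
    obtain ⟨n, hn⟩ := hl x List.mem_cons_self M hM.finite g
    refine .of_pow_smul hπ (fun g => ih ?_ hW (fun y hy => ?_) ?_ g) hn
    · rwa [Ideal.ofList_cons, ← sup_assoc] at hE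
    · have := hl y (List.mem_cons_of_mem _ hy)
      exact this.prod_projective.ker hπ this
    · obtain ⟨n, hn⟩ := hMN
      refine ⟨n + 1, fun j hj => ?_⟩
      obtain ⟨j, rfl⟩ : ∃ l, j = l + 1 := ⟨j - 1, by omega⟩
      exact ExtVanish.right₁ (Submodule.injective_subtype _) (coneMap x π).exact_subtype_ker_map hπ
        (hn j (by omega)) ((hn _ (by omega)).prod (hM.extVanish_projective _))

end StablyTorsion

section InjectiveHull

variable {R : Type u} [CommRing R]

theorem Submodule.exists_maximal_of_chain {J : Type u} [AddCommGroup J] [Module R J]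
    (p : J → Prop) (T₀ : Submodule R J) (hT₀ : ∀ x ∈ T₀, p x) :
    ∃ T : Submodule R J, T₀ ≤ T ∧ (∀ x ∈ T, p x) ∧
      ∀ T' : Submodule R J, T ≤ T' → (∀ x ∈ T', p x) → T' ≤ T := by
  obtain ⟨T, hT, hmax⟩ := zorn_le_nonempty₀ {T : Submodule R J | ∀ x ∈ T, p x} (by
    intro c hc hchain y hy
    refine ⟨sSup c, fun x hx => ?_, fun z hz => le_sSup hz⟩
    obtain ⟨T, hT, hxT⟩ := (Submodule.mem_sSup_of_directed ⟨y, hy⟩ hchain.directedOn).1 hx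
    exact hc hT x hxT) T₀ hT₀
  exact ⟨T, hT, hmax.1, fun T' h h' => hmax.2 h' h⟩

/-- Every submodule of an injective module has an injective essential extension inside it. -/
theorem Submodule.exists_injective_essential {J : Type u} [AddCommGroup J] [Module R J]
    [Module.Injective R J] (S : Submodule R J) :
    ∃ E : Submodule R J, S ≤ E ∧ (∀ x ∈ E, x ≠ 0 → ∃ r : R, r • x ∈ S ∧ r • x ≠ 0) ∧
      Module.Injective R E := by
  obtain ⟨E, hSE, hess, hEmax⟩ := Submodule.exists_maximal_of_chain
    (fun x : J => x ≠ 0 → ∃ r : R, r • x ∈ S ∧ r • x ≠ 0) S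
    fun x hx h => ⟨1, by simpa using hx, by simpa using h⟩
  refine ⟨E, hSE, hess, ?_⟩
  obtain ⟨C, -, hCE, hCmax⟩ := Submodule.exists_maximal_of_chain
    (fun x : J => x ∈ E → x = 0) ⊥ fun x hx _ => (Submodule.mem_bot R).1 hx
  have hinj : Function.Injective (C.mkQ ∘ₗ E.subtype) := by
    rw [← LinearMap.ker_eq_bot, LinearMap.ker_eq_bot']
    exact fun e he => Subtype.ext (hCE e ((Submodule.Quotient.mk_eq_zero _).1 he) e.2)
  obtain ⟨φ, hφ⟩ := Module.Injective.out _ hinj E.subtype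
  have hφ : ∀ e ∈ E, φ (C.mkQ e) = e := fun e he => hφ ⟨e, he⟩
  have hker : ∀ j, φ (C.mkQ j) = 0 → j ∈ C := by
    refine fun j hj => hCmax (LinearMap.ker (φ ∘ₗ C.mkQ)) (fun c hc => ?_) (fun x hx hxE => ?_) hj
    · simp [(Submodule.Quotient.mk_eq_zero C).2 hc]
    · rw [← hφ x hxE]
      exact hx
  have hmem : ∀ j, φ (C.mkQ j) ∈ E := by
    intro j
    refine hEmax (LinearMap.range (φ ∘ₗ C.mkQ)) (fun e he => ⟨e, hφ e he⟩) ?_ ⟨j, rfl⟩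
    rintro _ ⟨j, rfl⟩ hj
    rw [LinearMap.comp_apply] at hj ⊢
    have hjC : j ∉ C := fun h => hj (by simp [(Submodule.Quotient.mk_eq_zero C).2 h])
    obtain ⟨y, hy, hyE, hy0⟩ : ∃ y ∈ C ⊔ Submodule.span R {j}, y ∈ E ∧ y ≠ 0 := by
      by_contra! h
      exact hjC (hCmax _ le_sup_left h
        (Submodule.mem_sup_right (Submodule.mem_span_singleton_self j)))
    obtain ⟨c, hc, z, hz, rfl⟩ := Submodule.mem_sup.1 hy
    obtain ⟨r, rfl⟩ := Submodule.mem_span_singleton.1 hz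
    obtain ⟨s, hs, hs0⟩ := hess _ hyE hy0
    have h := hφ _ hyE
    rw [map_add, Submodule.mkQ_apply, (Submodule.Quotient.mk_eq_zero C).2 hc, zero_add, map_smul,
      map_smul] at h
    exact ⟨s * r, by rwa [mul_smul, h], by rwa [mul_smul, h]⟩
  refine ⟨fun X Y _ _ _ _ f hf g => ?_⟩
  obtain ⟨h, hh⟩ := Module.Injective.out f hf (E.subtype ∘ₗ g)
  refine ⟨(φ ∘ₗ C.mkQ ∘ₗ h).codRestrict E fun y => hmem _, fun x => Subtype.ext ?_⟩
  rw [LinearMap.codRestrict_apply, LinearMap.comp_apply, LinearMap.comp_apply, hh]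
  exact hφ _ (g x).2

theorem exists_injective_hull_quotient [IsNoetherianRing R] (m : Ideal R) [m.IsMaximal] :
    ∃ (E : Type u) (_ : AddCommGroup E) (_ : Module R E) (ι : (R ⧸ m) →ₗ[R] E),
      Module.Injective R E ∧ Function.Injective ι ∧
      (∀ y ∈ m, ∀ e : E, ∃ n : ℕ, y ^ n • e = 0) ∧
      ∀ e : E, (∀ y ∈ m, y • e = 0) → e ∈ LinearMap.range ι := by
  let J := Injective.under (ModuleCat.of R (R ⧸ m))
  have : Injective (ModuleCat.of R J) := inferInstanceAs (Injective J)
  have : Module.Injective R J := Module.injective_module_of_injective_object R J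
  let i : (R ⧸ m) →ₗ[R] J := (Injective.ι (ModuleCat.of R (R ⧸ m))).hom
  have hi : Function.Injective i := (ModuleCat.mono_iff_injective _).1 inferInstance
  obtain ⟨E, hSE, hess, hE⟩ := (LinearMap.range i).exists_injective_essential
  have hS : ∀ y ∈ m, ∀ x ∈ LinearMap.range i, y • x = 0 := by
    rintro y hy _ ⟨x, rfl⟩
    obtain ⟨x, rfl⟩ := Submodule.mkQ_surjective _ x
    rw [← map_smul, ← map_smul, smul_eq_mul, Submodule.mkQ_apply,
      (Submodule.Quotient.mk_eq_zero m).2 (m.mul_mem_right x hy), map_zero]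
  refine ⟨E, inferInstance, inferInstance, i.codRestrict E fun x => hSE ⟨x, rfl⟩, hE,
    fun x y h => hi (congrArg Subtype.val h), fun y hy e => ?_, fun e he => ?_⟩
  · let a : ℕ →o Ideal R := ⟨fun n => LinearMap.ker (LinearMap.toSpanSingleton R E (y ^ n • e)),
      monotone_nat_of_le_succ fun n r hr => by
        have hr : r • y ^ n • e = 0 := hr
        change r • y ^ (n + 1) • e = 0
        rw [pow_succ', mul_smul, smul_comm, hr, smul_zero]⟩
    obtain ⟨n, hn⟩ := monotone_stabilizes_iff_noetherian.2 ‹IsNoetherianRing R› a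
    refine ⟨n, ?_⟩
    by_contra h0
    obtain ⟨r, hr, hr0⟩ := hess (y ^ n • e : E) (Submodule.coe_mem _)
      fun h => h0 (Subtype.ext h)
    have hmem : r ∈ a (n + 1) := by
      change r • y ^ (n + 1) • e = 0
      have := hS y hy _ hr
      refine Subtype.ext ?_
      rw [pow_succ', mul_smul, smul_comm]
      exact this
    rw [← hn (n + 1) (by omega)] at hmem
    exact hr0 (congrArg Subtype.val (show r • y ^ n • e = 0 from hmem))
  · by_cases h0 : e = 0
    · exact h0 ▸ zero_mem _
    obtain ⟨r, hr, hr0⟩ := hess e e.2 fun h => h0 (Subtype.ext h)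
    have hrm : r ∉ m := fun h => hr0 (congrArg Subtype.val (he r h))
    obtain ⟨s, y, hy, hsy⟩ := Ideal.IsMaximal.exists_inv ‹m.IsMaximal› hrm
    obtain ⟨z, hz⟩ := hr
    refine ⟨s • z, Subtype.ext ?_⟩
    have : s • r • e = e := by
      rw [← mul_smul, eq_sub_of_add_eq hsy, sub_smul, he y hy, one_smul, sub_zero]
    rw [LinearMap.codRestrict_apply, map_smul, hz]
    exact congrArg Subtype.val this

theorem IsExtAcyclic.exists_dual_apply_ne_zero [IsNoetherianRing R] (hAC : SatisfiesAC R)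
    {M : Type u} [AddCommGroup M] [Module R M] (hM : IsExtAcyclic R M) {z : M} (hz : z ≠ 0) :
    ∃ f : M →ₗ[R] R, f z ≠ 0 := by
  let t := LinearMap.toSpanSingleton R M z
  obtain ⟨m, hm, hle⟩ := Ideal.exists_le_maximal (LinearMap.ker t) fun h => hz (by
    have : (1 : R) ∈ LinearMap.ker t := h ▸ Submodule.mem_top
    simpa [t] using this)
  obtain ⟨E, _, _, ι, _, hι, htor, hsoc⟩ := exists_injective_hull_quotient m
  obtain ⟨g, hg⟩ := Module.Injective.out ((LinearMap.ker t).liftQ t le_rfl)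
    (LinearMap.ker_eq_bot.1 (Submodule.ker_liftQ_eq_bot _ _ _ le_rfl))
    ((LinearMap.ker t).liftQ (ι ∘ₗ m.mkQ) fun r hr => by
      rw [LinearMap.mem_ker, LinearMap.comp_apply, Submodule.mkQ_apply,
        (Submodule.Quotient.mk_eq_zero m).2 (hle hr), map_zero])
  have hgz : g z ≠ 0 := by
    have := hg (Submodule.Quotient.mk 1)
    simp only [Submodule.liftQ_apply, t, LinearMap.toSpanSingleton_apply, one_smul] at this
    rw [this, LinearMap.comp_apply, Ne, map_eq_zero_iff ι hι, Submodule.mkQ_apply,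
      Submodule.Quotient.mk_eq_zero]
    exact fun h => hm.ne_top (m.eq_top_iff_one.2 h)
  obtain ⟨s, hs⟩ := IsNoetherian.noetherian m
  have hfin : ∀ (X : Type u) [AddCommGroup X] [Module R X], Module.Finite R X →
      ⊥ ⊔ Ideal.ofList s.toList ≤ Module.annihilator R X → Module.Finite R (X →ₗ[R] E) := by
    intro X _ _ _ hX
    have hmX : m ≤ Module.annihilator R X := by
      refine le_trans (le_of_eq ?_) (le_sup_right.trans hX)
      rw [← hs]
      simp only [Ideal.ofList, Finset.mem_toList, Finset.setOfPred_mem]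
    obtain ⟨n, p, hp⟩ := Module.Finite.exists_fin' R X
    let ev : (X →ₗ[R] E) →ₗ[R] (Fin n → LinearMap.range ι) :=
      LinearMap.pi fun k => (LinearMap.applyₗ (p (Pi.single k 1))).codRestrict _ fun φ =>
        hsoc _ fun y hy => by
          rw [LinearMap.applyₗ_apply_apply, ← map_smul,
            Module.mem_annihilator.1 (hmX hy), map_zero]
    refine Module.Finite.of_injective ev fun φ ψ h => ?_
    refine LinearMap.cancel_right hp |>.1 (LinearMap.pi_ext' fun k => LinearMap.ext_ring ?_)
    exact congrArg Subtype.val (congrFun h k)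
  have hstab : StablyZero g := DualClass.stablyZero hAC hM s.toList hfin
    (.dual (X := R) inferInstance bot_le (LinearMap.ringLmapEquivSelf R R E).symm)
    (fun y hy => .of_torsion (htor y (hs ▸ Submodule.subset_span (Finset.mem_toList.1 hy))))
    ⟨1, fun j hj => by
      obtain ⟨j, rfl⟩ : ∃ l, j = l + 1 := ⟨j - 1, by omega⟩
      exact .of_injective j⟩ g
  obtain ⟨P, _, _, _, a, b, rfl⟩ := hstab
  obtain ⟨s, hs⟩ := Module.projective_def'.1 ‹Module.Projective R P›
  have hs : ∀ x, Finsupp.linearCombination R id (s x) = x := LinearMap.congr_fun hs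
  by_contra! h
  refine hgz ?_
  have : s (a z) = 0 := Finsupp.ext fun k => h (Finsupp.lapply k ∘ₗ s ∘ₗ a)
  rw [LinearMap.comp_apply, ← hs (a z), this, map_zero, map_zero]

end InjectiveHull

section Reflexive

variable {R : Type u} [CommRing R]

theorem LinearMap.dualMap_exact {A B C : Type u} [AddCommGroup A] [Module R A] [AddCommGroup B]
    [Module R B] [AddCommGroup C] [Module R C] {f : A →ₗ[R] B} {g : B →ₗ[R] C}
    (hfg : Function.Exact f g) (hg : Function.Surjective g) :
    Function.Exact g.dualMap f.dualMap := by
  intro φ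
  constructor
  · intro hφ
    obtain ⟨ψ, hψ⟩ := exists_desc hg φ fun b hb => by
      obtain ⟨a, rfl⟩ := (hfg b).1 hb
      exact LinearMap.congr_fun hφ a
    exact ⟨ψ, LinearMap.ext hψ⟩
  · rintro ⟨ψ, rfl⟩
    refine LinearMap.ext fun a => ?_
    rw [LinearMap.dualMap_apply, LinearMap.dualMap_apply, (hfg _).2 ⟨a, rfl⟩, map_zero]
    rfl

namespace IsExtAcyclic

variable [IsNoetherianRing R]

theorem eq_zero_of_forall_dual (hAC : SatisfiesAC R) {M : Type u} [AddCommGroup M] [Module R M]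
    (hM : IsExtAcyclic R M) {z : M} (hz : ∀ f : M →ₗ[R] R, f z = 0) : z = 0 := by
  by_contra h
  obtain ⟨f, hf⟩ := hM.exists_dual_apply_ne_zero hAC h
  exact hf (hz f)

/-- An Ext-acyclic module embeds in a finite free module with Ext-acyclic cokernel, in such a way
that every functional extends. -/
theorem exists_coresolution (hAC : SatisfiesAC R) {M : Type u} [AddCommGroup M] [Module R M]
    (hM : IsExtAcyclic R M) :
    ∃ (n : ℕ) (φ : M →ₗ[R] (Fin n → R)), Function.Injective φ ∧
      Function.Surjective φ.dualMap ∧ IsExtAcyclic R ((Fin n → R) ⧸ LinearMap.range φ) := by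
  have := hM.finite
  obtain ⟨n, p, hp⟩ := Module.Finite.exists_fin' R (Module.Dual R M)
  let φ : M →ₗ[R] (Fin n → R) := LinearMap.pi fun k => p (Pi.single k 1)
  have hφ : Function.Surjective φ.dualMap := by
    intro f
    obtain ⟨v, rfl⟩ := hp f
    refine ⟨∑ k, v k • LinearMap.proj k, LinearMap.ext fun x => ?_⟩
    have hv : v = ∑ k, v k • Pi.single k (1 : R) := by
      simpa using (Pi.basisFun R (Fin n)).sum_repr v |>.symm
    conv_rhs => rw [hv]
    simp [φ]
  have hinj : Function.Injective φ := by
    rw [← LinearMap.ker_eq_bot, LinearMap.ker_eq_bot']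
    intro x hx
    refine hM.eq_zero_of_forall_dual hAC fun f => ?_
    obtain ⟨ψ, rfl⟩ := hφ f
    simp [hx]
  refine ⟨n, φ, hinj, hφ, inferInstance, fun i => ?_⟩
  have hex : Function.Exact φ (LinearMap.range φ).mkQ := LinearMap.exact_map_mkQ_range φ
  have hs := Submodule.mkQ_surjective (LinearMap.range φ)
  cases i with
  | zero => exact ExtVanish.one_of_exists_extension hinj hex hs (.of_projective 0) hφ
  | succ i => exact ExtVanish.left₃ hinj hex hs (hM.extVanish i) (.of_projective _)

theorem eval_bijective (hAC : SatisfiesAC R) {M : Type u} [AddCommGroup M] [Module R M]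
    (hM : IsExtAcyclic R M) : Function.Bijective (Module.Dual.eval R M) := by
  refine ⟨(injective_iff_map_eq_zero _).2 fun z hz =>
    hM.eq_zero_of_forall_dual hAC (LinearMap.congr_fun hz), fun u => ?_⟩
  obtain ⟨n, φ, hinj, hφ, hC⟩ := hM.exists_coresolution hAC
  obtain ⟨v, hv⟩ := (Module.evalEquiv R (Fin n → R)).surjective (u ∘ₗ φ.dualMap)
  have hv : ∀ f : Module.Dual R (Fin n → R), f v = u (φ.dualMap f) := LinearMap.congr_fun hv
  have hvC : (LinearMap.range φ).mkQ v = 0 := by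
    refine hC.eq_zero_of_forall_dual hAC fun f => ?_
    have h0 : φ.dualMap (f ∘ₗ (LinearMap.range φ).mkQ) = 0 := LinearMap.ext fun x => by
      change f (Submodule.Quotient.mk (φ x)) = 0
      rw [(Submodule.Quotient.mk_eq_zero (LinearMap.range φ)).2 ⟨x, rfl⟩, map_zero]
    have := hv (f ∘ₗ (LinearMap.range φ).mkQ)
    rwa [h0, map_zero] at this
  obtain ⟨x, rfl⟩ := (Submodule.Quotient.mk_eq_zero _).1 hvC
  refine ⟨x, LinearMap.ext fun f => ?_⟩
  obtain ⟨ψ, rfl⟩ := hφ f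
  exact hv ψ

theorem extVanish_dual (hAC : SatisfiesAC R) {M : Type u} [AddCommGroup M] [Module R M]
    (hM : IsExtAcyclic R M) (i : ℕ) : ExtVanish R (Module.Dual R M) R (i + 1) := by
  induction i generalizing M with
  | zero =>
    obtain ⟨n, φ, hinj, hφ, hC⟩ := hM.exists_coresolution hAC
    have hs := Submodule.mkQ_surjective (LinearMap.range φ)
    refine ExtVanish.one_of_exists_extension (LinearMap.dualMap_injective_of_surjective hs)
      (LinearMap.dualMap_exact (LinearMap.exact_map_mkQ_range φ) hs) hφ (.of_projective 0)
      fun u => ?_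
    obtain ⟨c, rfl⟩ := (hC.eval_bijective hAC).2 u
    obtain ⟨v, rfl⟩ := hs c
    exact ⟨Module.Dual.eval R _ v, rfl⟩
  | succ i ih =>
    obtain ⟨n, φ, hinj, hφ, hC⟩ := hM.exists_coresolution hAC
    have hs := Submodule.mkQ_surjective (LinearMap.range φ)
    exact ExtVanish.left₃ (LinearMap.dualMap_injective_of_surjective hs)
      (LinearMap.dualMap_exact (LinearMap.exact_map_mkQ_range φ) hs) hφ (ih hC)
      (.of_projective _)

end IsExtAcyclic

end Reflexive

/-- A commutative noetherian ring satisfying (AC) satisfies (GC): every finitely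
generated module `M` with `Ext^{≥1}(M, R) = 0` is totally reflexive, i.e. the
biduality map `M → Hom_R(Hom_R(M, R), R)` is an isomorphism and
`Ext^i(Hom_R(M, R), R) = 0` for all `i ≥ 1`. -/
theorem stmt5 (R : Type u) [CommRing R] [IsNoetherianRing R] (hAC : SatisfiesAC R)
    (M : ModuleCat.{u} R) (hM : Module.Finite R M)
    (hvan : ∀ (i : ℕ), 1 ≤ i → Subsingleton (ExtGroup M (ModuleCat.of R R) i)) :
    Function.Bijective (Module.Dual.eval R M) ∧
    ∀ (i : ℕ), 1 ≤ i →
      Subsingleton (ExtGroup (ModuleCat.of R (Module.Dual R M)) (ModuleCat.of R R) i) := by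
  have hM' : IsExtAcyclic R M :=
    ⟨hM, fun i => (subsingleton_extGroup_succ_iff M (ModuleCat.of R R) i).1 (hvan _ (by omega))⟩
  refine ⟨hM'.eval_bijective hAC, fun i hi => ?_⟩
  obtain ⟨i, rfl⟩ : ∃ j, i = j + 1 := ⟨i - 1, by omega⟩
  exact (subsingleton_extGroup_succ_iff _ _ i).2 (hM'.extVanish_dual hAC i)
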